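/- arXiv:2304.13321 — 2 statements merged into one kernel-verified Lean document; each statement's English description precedes it below -/
import Mathlib

section
/- If a congruence on terms and propositions is defined by a confluent rewrite system whose rules rewrite terms to terms and atomic propositions to propositions, then the congruence is non-confusing. -/
set_option maxHeartbeats 1000000

attribute [local instance] Classical.propDecidable

namespace DeductionModulo

/-- A many-sorted first-order language: sorts, function symbols with their
ranks, and predicate symbols with their ranks. -/
structure Lang where
  Srt : Type
  Fn : Type
  arity : Fn → ℕ
  dom : (f : Fn) → Fin (arity f) → Srt
  cod : Fn → Srt
  Pr : Type
  parity : Pr → ℕ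
  pdom : (P : Pr) → Fin (parity P) → Srt

variable {L : Lang}

/-- Terms of the language, intrinsically sorted. -/
inductive Tm (L : Lang) : L.Srt → Type where
  | var (x : ℕ) (s : L.Srt) : Tm L s
  | app (f : L.Fn) (args : (i : Fin (L.arity f)) → Tm L (L.dom f i)) : Tm L (L.cod f)

/-- Propositions of the language. -/
inductive Fm (L : Lang) : Type where
  | atom (P : L.Pr) (args : (i : Fin (L.parity P)) → Tm L (L.pdom P i)) : Fm L
  | top : Fm L
  | bot : Fm L
  | and (A B : Fm L) : Fm L
  | or (A B : Fm L) : Fm L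
  | imp (A B : Fm L) : Fm L
  | all (x : ℕ) (s : L.Srt) (A : Fm L) : Fm L
  | ex (x : ℕ) (s : L.Srt) (A : Fm L) : Fm L

/-- Simultaneous substitutions of terms for variables. -/
def Sub (L : Lang) : Type := (s : L.Srt) → ℕ → Tm L s

/-- Protect a bound variable in a substitution. -/
noncomputable def Sub.bind (σ : Sub L) (x : ℕ) (s : L.Srt) : Sub L :=
  fun s' y => if s' = s ∧ y = x then Tm.var y s' else σ s' y

noncomputable def Tm.ssub (σ : Sub L) : {s : L.Srt} → Tm L s → Tm L s
  | _, .var x s => σ s x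
  | _, .app f args => .app f (fun i => (args i).ssub σ)

noncomputable def Fm.ssub (σ : Sub L) : Fm L → Fm L
  | .atom P args => .atom P (fun i => (args i).ssub σ)
  | .top => .top
  | .bot => .bot
  | .and A B => .and (A.ssub σ) (B.ssub σ)
  | .or A B => .or (A.ssub σ) (B.ssub σ)
  | .imp A B => .imp (A.ssub σ) (B.ssub σ)
  | .all x s A => .all x s (A.ssub (σ.bind x s))
  | .ex x s A => .ex x s (A.ssub (σ.bind x s))

/-- The substitution of a single term `t` for the variable `x` of sort `s`. -/
noncomputable def Sub.single (x : ℕ) {s : L.Srt} (t : Tm L s) : Sub L :=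
  fun s' y => if h : s' = s ∧ y = x then cast (congrArg (Tm L) h.1.symm) t else Tm.var y s'

/-- `(t/x)A`. -/
noncomputable def Fm.subst (x : ℕ) {s : L.Srt} (t : Tm L s) (A : Fm L) : Fm L :=
  A.ssub (Sub.single x t)

/-- Free variables of a term (with their sorts). -/
def Tm.fv : {s : L.Srt} → Tm L s → Set (L.Srt × ℕ)
  | _, .var x s => {(s, x)}
  | _, .app _ args => ⋃ i, (args i).fv

/-- Free variables of a proposition (with their sorts). -/
def Fm.fv : Fm L → Set (L.Srt × ℕ)
  | .atom _ args => ⋃ i, (args i).fv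
  | .top => ∅
  | .bot => ∅
  | .and A B => A.fv ∪ B.fv
  | .or A B => A.fv ∪ B.fv
  | .imp A B => A.fv ∪ B.fv
  | .all x s A => A.fv \ {(s, x)}
  | .ex x s A => A.fv \ {(s, x)}

/-- A congruence on the terms and propositions of the language: an equivalence
relation on terms of each sort and on propositions, compatible with the
structure of terms and propositions. -/
structure Congr (L : Lang) where
  tm : {s : L.Srt} → Tm L s → Tm L s → Prop
  fm : Fm L → Fm L → Prop
  tm_refl : ∀ {s : L.Srt} (t : Tm L s), tm t t
  tm_symm : ∀ {s : L.Srt} {t u : Tm L s}, tm t u → tm u t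
  tm_trans : ∀ {s : L.Srt} {t u v : Tm L s}, tm t u → tm u v → tm t v
  fm_refl : ∀ A : Fm L, fm A A
  fm_symm : ∀ {A B : Fm L}, fm A B → fm B A
  fm_trans : ∀ {A B C : Fm L}, fm A B → fm B C → fm A C
  app_congr : ∀ (f : L.Fn) (args args' : (i : Fin (L.arity f)) → Tm L (L.dom f i)),
      (∀ i, tm (args i) (args' i)) → tm (Tm.app f args) (Tm.app f args')
  atom_congr : ∀ (P : L.Pr) (args args' : (i : Fin (L.parity P)) → Tm L (L.pdom P i)),
      (∀ i, tm (args i) (args' i)) → fm (Fm.atom P args) (Fm.atom P args')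
  and_congr : ∀ {A A' B B' : Fm L}, fm A A' → fm B B' → fm (Fm.and A B) (Fm.and A' B')
  or_congr : ∀ {A A' B B' : Fm L}, fm A A' → fm B B' → fm (Fm.or A B) (Fm.or A' B')
  imp_congr : ∀ {A A' B B' : Fm L}, fm A A' → fm B B' → fm (Fm.imp A B) (Fm.imp A' B')
  all_congr : ∀ (x : ℕ) (s : L.Srt) {A A' : Fm L}, fm A A' → fm (Fm.all x s A) (Fm.all x s A')
  ex_congr : ∀ (x : ℕ) (s : L.Srt) {A A' : Fm L}, fm A A' → fm (Fm.ex x s A) (Fm.ex x s A')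

/-- Proof-terms. -/
inductive Pf (L : Lang) : Type where
  | pvar (α : ℕ) : Pf L
  | triv : Pf L
  | botElim (π : Pf L) : Pf L
  | pair (π₁ π₂ : Pf L) : Pf L
  | fst (π : Pf L) : Pf L
  | snd (π : Pf L) : Pf L
  | inl (π : Pf L) : Pf L
  | inr (π : Pf L) : Pf L
  | case (π₁ : Pf L) (α : ℕ) (π₂ : Pf L) (β : ℕ) (π₃ : Pf L) : Pf L
  | lam (α : ℕ) (π : Pf L) : Pf L
  | app (π₁ π₂ : Pf L) : Pf L
  | tlam (x : ℕ) (s : L.Srt) (π : Pf L) : Pf L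
  | tapp (π : Pf L) (s : L.Srt) (t : Tm L s) : Pf L
  | wit (s : L.Srt) (t : Tm L s) (π : Pf L) : Pf L
  | exElim (π₁ : Pf L) (x : ℕ) (s : L.Srt) (α : ℕ) (π₂ : Pf L) : Pf L

/-- Substitution `(ρ/α)π` of a proof-term for a proof variable. -/
noncomputable def Pf.psub : Pf L → ℕ → Pf L → Pf L
  | .pvar β, α, ρ => if β = α then ρ else .pvar β
  | .triv, _, _ => .triv
  | .botElim π, α, ρ => .botElim (π.psub α ρ)
  | .pair π₁ π₂, α, ρ => .pair (π₁.psub α ρ) (π₂.psub α ρ)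
  | .fst π, α, ρ => .fst (π.psub α ρ)
  | .snd π, α, ρ => .snd (π.psub α ρ)
  | .inl π, α, ρ => .inl (π.psub α ρ)
  | .inr π, α, ρ => .inr (π.psub α ρ)
  | .case π₁ β π₂ γ π₃, α, ρ =>
      .case (π₁.psub α ρ) β (if β = α then π₂ else π₂.psub α ρ) γ
        (if γ = α then π₃ else π₃.psub α ρ)
  | .lam β π, α, ρ => .lam β (if β = α then π else π.psub α ρ)
  | .app π₁ π₂, α, ρ => .app (π₁.psub α ρ) (π₂.psub α ρ)
  | .tlam x s π, α, ρ => .tlam x s (π.psub α ρ)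
  | .tapp π s t, α, ρ => .tapp (π.psub α ρ) s t
  | .wit s t π, α, ρ => .wit s t (π.psub α ρ)
  | .exElim π₁ x s β π₂, α, ρ =>
      .exElim (π₁.psub α ρ) x s β (if β = α then π₂ else π₂.psub α ρ)

/-- Substitution `(t/x)π` of a term for a term variable in a proof-term. -/
noncomputable def Pf.tsub : Pf L → ℕ → (s : L.Srt) → Tm L s → Pf L
  | .pvar β, _, _, _ => .pvar β
  | .triv, _, _, _ => .triv
  | .botElim π, x, s, t => .botElim (π.tsub x s t)
  | .pair π₁ π₂, x, s, t => .pair (π₁.tsub x s t) (π₂.tsub x s t)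
  | .fst π, x, s, t => .fst (π.tsub x s t)
  | .snd π, x, s, t => .snd (π.tsub x s t)
  | .inl π, x, s, t => .inl (π.tsub x s t)
  | .inr π, x, s, t => .inr (π.tsub x s t)
  | .case π₁ β π₂ γ π₃, x, s, t =>
      .case (π₁.tsub x s t) β (π₂.tsub x s t) γ (π₃.tsub x s t)
  | .lam β π, x, s, t => .lam β (π.tsub x s t)
  | .app π₁ π₂, x, s, t => .app (π₁.tsub x s t) (π₂.tsub x s t)
  | .tlam y s' π, x, s, t => .tlam y s' (if s' = s ∧ y = x then π else π.tsub x s t)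
  | .tapp π s' u, x, s, t => .tapp (π.tsub x s t) s' (u.ssub (Sub.single x t))
  | .wit s' u π, x, s, t => .wit s' (u.ssub (Sub.single x t)) (π.tsub x s t)
  | .exElim π₁ y s' β π₂, x, s, t =>
      .exElim (π₁.tsub x s t) y s' β (if s' = s ∧ y = x then π₂ else π₂.tsub x s t)

/-- The cut-elimination reduction `▷` on proof-terms (one step, at any position). -/
inductive Red : Pf L → Pf L → Prop where
  | fstPair (π₁ π₂ : Pf L) : Red (.fst (.pair π₁ π₂)) π₁
  | sndPair (π₁ π₂ : Pf L) : Red (.snd (.pair π₁ π₂)) π₂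
  | caseInl (π₁ : Pf L) (α : ℕ) (π₂ : Pf L) (β : ℕ) (π₃ : Pf L) :
      Red (.case (.inl π₁) α π₂ β π₃) (π₂.psub α π₁)
  | caseInr (π₁ : Pf L) (α : ℕ) (π₂ : Pf L) (β : ℕ) (π₃ : Pf L) :
      Red (.case (.inr π₁) α π₂ β π₃) (π₃.psub β π₁)
  | beta (α : ℕ) (π₁ π₂ : Pf L) : Red (.app (.lam α π₁) π₂) (π₁.psub α π₂)
  | tbeta (x : ℕ) (s : L.Srt) (π : Pf L) (t : Tm L s) :
      Red (.tapp (.tlam x s π) s t) (π.tsub x s t)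
  | exBeta (s : L.Srt) (t : Tm L s) (π₁ : Pf L) (x α : ℕ) (π₂ : Pf L) :
      Red (.exElim (.wit s t π₁) x s α π₂) ((π₂.tsub x s t).psub α π₁)
  | botElimC {π π' : Pf L} : Red π π' → Red (.botElim π) (.botElim π')
  | pairC₁ {π₁ π₁' : Pf L} (π₂ : Pf L) : Red π₁ π₁' → Red (.pair π₁ π₂) (.pair π₁' π₂)
  | pairC₂ (π₁ : Pf L) {π₂ π₂' : Pf L} : Red π₂ π₂' → Red (.pair π₁ π₂) (.pair π₁ π₂')
  | fstC {π π' : Pf L} : Red π π' → Red (.fst π) (.fst π')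
  | sndC {π π' : Pf L} : Red π π' → Red (.snd π) (.snd π')
  | inlC {π π' : Pf L} : Red π π' → Red (.inl π) (.inl π')
  | inrC {π π' : Pf L} : Red π π' → Red (.inr π) (.inr π')
  | caseC₁ {π₁ π₁' : Pf L} (α : ℕ) (π₂ : Pf L) (β : ℕ) (π₃ : Pf L) :
      Red π₁ π₁' → Red (.case π₁ α π₂ β π₃) (.case π₁' α π₂ β π₃)
  | caseC₂ (π₁ : Pf L) (α : ℕ) {π₂ π₂' : Pf L} (β : ℕ) (π₃ : Pf L) :
      Red π₂ π₂' → Red (.case π₁ α π₂ β π₃) (.case π₁ α π₂' β π₃)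
  | caseC₃ (π₁ : Pf L) (α : ℕ) (π₂ : Pf L) (β : ℕ) {π₃ π₃' : Pf L} :
      Red π₃ π₃' → Red (.case π₁ α π₂ β π₃) (.case π₁ α π₂ β π₃')
  | lamC (α : ℕ) {π π' : Pf L} : Red π π' → Red (.lam α π) (.lam α π')
  | appC₁ {π₁ π₁' : Pf L} (π₂ : Pf L) : Red π₁ π₁' → Red (.app π₁ π₂) (.app π₁' π₂)
  | appC₂ (π₁ : Pf L) {π₂ π₂' : Pf L} : Red π₂ π₂' → Red (.app π₁ π₂) (.app π₁ π₂')
  | tlamC (x : ℕ) (s : L.Srt) {π π' : Pf L} : Red π π' → Red (.tlam x s π) (.tlam x s π')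
  | tappC {π π' : Pf L} (s : L.Srt) (t : Tm L s) : Red π π' → Red (.tapp π s t) (.tapp π' s t)
  | witC (s : L.Srt) (t : Tm L s) {π π' : Pf L} : Red π π' → Red (.wit s t π) (.wit s t π')
  | exElimC₁ {π₁ π₁' : Pf L} (x : ℕ) (s : L.Srt) (α : ℕ) (π₂ : Pf L) :
      Red π₁ π₁' → Red (.exElim π₁ x s α π₂) (.exElim π₁' x s α π₂)
  | exElimC₂ (π₁ : Pf L) (x : ℕ) (s : L.Srt) (α : ℕ) {π₂ π₂' : Pf L} :
      Red π₂ π₂' → Red (.exElim π₁ x s α π₂) (.exElim π₁ x s α π₂')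

/-- `π ▷* π'`. -/
def RedStar : Pf L → Pf L → Prop := Relation.ReflTransGen Red

/-- A proof-term is strongly normalizing if its reduction tree is finite,
i.e. there is no infinite reduction sequence out of it. -/
def SN (π : Pf L) : Prop := Acc (fun a b : Pf L => Red b a) π

/-- The set `SN` of strongly normalizing proof-terms. -/
def SNset (L : Lang) : Set (Pf L) := {π | SN π}

/-- A proof-term is normal if it admits no reduction. -/
def Normal (π : Pf L) : Prop := ∀ π', ¬ Red π π'

/-- Neutral proofs: axioms and eliminations, but not introductions. -/
def Neutral : Pf L → Prop := fun π =>
  match π with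
  | .pvar _ => True
  | .botElim _ => True
  | .fst _ => True
  | .snd _ => True
  | .case _ _ _ _ _ => True
  | .app _ _ => True
  | .tapp _ _ _ => True
  | .exElim _ _ _ _ _ => True
  | _ => False

/-- Proofs ending with an introduction rule. -/
def isIntro : Pf L → Prop := fun π =>
  match π with
  | .triv => True
  | .pair _ _ => True
  | .inl _ => True
  | .inr _ => True
  | .lam _ _ => True
  | .tlam _ _ _ => True
  | .wit _ _ _ => True
  | _ => False

/-- Free proof variables of a proof-term. -/
def Pf.pfv : Pf L → Set ℕ
  | .pvar α => {α}
  | .triv => ∅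
  | .botElim π => π.pfv
  | .pair π₁ π₂ => π₁.pfv ∪ π₂.pfv
  | .fst π => π.pfv
  | .snd π => π.pfv
  | .inl π => π.pfv
  | .inr π => π.pfv
  | .case π₁ α π₂ β π₃ => π₁.pfv ∪ (π₂.pfv \ {α}) ∪ (π₃.pfv \ {β})
  | .lam α π => π.pfv \ {α}
  | .app π₁ π₂ => π₁.pfv ∪ π₂.pfv
  | .tlam _ _ π => π.pfv
  | .tapp π _ _ => π.pfv
  | .wit _ _ π => π.pfv
  | .exElim π₁ _ _ α π₂ => π₁.pfv ∪ (π₂.pfv \ {α})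

/-- Free term variables of a proof-term. -/
def Pf.tfv : Pf L → Set (L.Srt × ℕ)
  | .pvar _ => ∅
  | .triv => ∅
  | .botElim π => π.tfv
  | .pair π₁ π₂ => π₁.tfv ∪ π₂.tfv
  | .fst π => π.tfv
  | .snd π => π.tfv
  | .inl π => π.tfv
  | .inr π => π.tfv
  | .case π₁ _ π₂ _ π₃ => π₁.tfv ∪ π₂.tfv ∪ π₃.tfv
  | .lam _ π => π.tfv
  | .app π₁ π₂ => π₁.tfv ∪ π₂.tfv
  | .tlam x s π => π.tfv \ {(s, x)}
  | .tapp π _ t => π.tfv ∪ t.fv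
  | .wit _ t π => t.fv ∪ π.tfv
  | .exElim π₁ x s _ π₂ => π₁.tfv ∪ (π₂.tfv \ {(s, x)})

/-- A closed proof-term: no free proof variables, no free term variables. -/
def ClosedPf (π : Pf L) : Prop := π.pfv = ∅ ∧ π.tfv = ∅

/-- Reducibility candidates (Girard). -/
def isCand (R : Set (Pf L)) : Prop :=
  (∀ π ∈ R, SN π) ∧
  (∀ π ∈ R, ∀ π', RedStar π π' → π' ∈ R) ∧
  (∀ π : Pf L, Neutral π → (∀ π', Red π π' → π' ∈ R) → π ∈ R)

/-- The operation `∧̃` on candidates. -/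
def cAnd (A B : Set (Pf L)) : Set (Pf L) :=
  {π | SN π ∧ ∀ π₁ π₂, RedStar π (.pair π₁ π₂) → π₁ ∈ A ∧ π₂ ∈ B}

/-- The operation `∨̃` on candidates. -/
def cOr (A B : Set (Pf L)) : Set (Pf L) :=
  {π | SN π ∧ (∀ π₁, RedStar π (.inl π₁) → π₁ ∈ A) ∧ (∀ π₂, RedStar π (.inr π₂) → π₂ ∈ B)}

/-- The operation `⇒̃` on candidates. -/
def cImp (A B : Set (Pf L)) : Set (Pf L) :=
  {π | SN π ∧ ∀ (α : ℕ) (π' : Pf L), RedStar π (.lam α π') → ∀ σ ∈ A, π'.psub α σ ∈ B}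

/-- The operation `∀̃` on sets of candidates. -/
def cAll (𝒜 : Set (Set (Pf L))) : Set (Pf L) :=
  {π | SN π ∧ ∀ (x : ℕ) (s : L.Srt) (π' : Pf L), RedStar π (.tlam x s π') →
      ∀ X ∈ 𝒜, ∀ t : Tm L s, π'.tsub x s t ∈ X}

/-- The operation `∃̃` on sets of candidates. -/
def cEx (𝒜 : Set (Set (Pf L))) : Set (Pf L) :=
  {π | SN π ∧ ∀ (s : L.Srt) (t : Tm L s) (π' : Pf L), RedStar π (.wit s t π') →
      ∃ X ∈ 𝒜, π' ∈ X}

/-- A `C`-model: a model valued in the algebra of reducibility candidates. -/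
structure CModel (L : Lang) where
  M : L.Srt → Type
  ne : ∀ s, Nonempty (M s)
  fn : ∀ f : L.Fn, ((i : Fin (L.arity f)) → M (L.dom f i)) → M (L.cod f)
  pr : ∀ P : L.Pr, ((i : Fin (L.parity P)) → M (L.pdom P i)) → Set (Pf L)
  pr_cand : ∀ (P : L.Pr) (v : (i : Fin (L.parity P)) → M (L.pdom P i)), isCand (pr P v)

/-- Assignments. -/
def Assign (M : CModel L) : Type := (s : L.Srt) → ℕ → M.M s

noncomputable def Assign.update {M : CModel L} (φ : Assign M) (x : ℕ) (s : L.Srt)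
    (a : M.M s) : Assign M :=
  fun s' y => if h : s' = s ∧ y = x then cast (congrArg M.M h.1.symm) a else φ s' y

/-- Denotation of a term in a `C`-model. -/
noncomputable def denT (M : CModel L) (φ : Assign M) : {s : L.Srt} → Tm L s → M.M s
  | _, .var x s => φ s x
  | _, .app f args => M.fn f (fun i => denT M φ (args i))

/-- Denotation of a proposition in a `C`-model. -/
noncomputable def denF (M : CModel L) (φ : Assign M) : Fm L → Set (Pf L)
  | .atom P args => M.pr P (fun i => denT M φ (args i))
  | .top => SNset L
  | .bot => SNset L
  | .and A B => cAnd (denF M φ A) (denF M φ B)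
  | .or A B => cOr (denF M φ A) (denF M φ B)
  | .imp A B => cImp (denF M φ A) (denF M φ B)
  | .all x s A => cAll {X | ∃ a : M.M s, X = denF M (φ.update x s a) A}
  | .ex x s A => cEx {X | ∃ a : M.M s, X = denF M (φ.update x s a) A}

/-- `M` is a `C`-model of the congruence `E`. -/
def isModelOf (M : CModel L) (E : Congr L) : Prop :=
  ∀ A B : Fm L, E.fm A B → ∀ φ : Assign M, denF M φ A = denF M φ B

/-- Contexts: named hypotheses. -/
abbrev Ctx (L : Lang) : Type := List (ℕ × Fm L)

def ctxFv (Γ : Ctx L) : Set (L.Srt × ℕ) := {p | ∃ q ∈ Γ, p ∈ q.2.fv}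

/-- Intuitionistic natural deduction modulo a congruence `E` (Fig. 1),
presented on proof-terms. -/
inductive ND (E : Congr L) : Ctx L → Pf L → Fm L → Prop where
  | ax {Γ : Ctx L} {α : ℕ} {A B : Fm L} :
      (α, A) ∈ Γ → E.fm A B → ND E Γ (.pvar α) B
  | topI {Γ : Ctx L} {A : Fm L} : E.fm A .top → ND E Γ .triv A
  | botE {Γ : Ctx L} {π : Pf L} {A B : Fm L} :
      ND E Γ π B → E.fm B .bot → ND E Γ (.botElim π) A
  | andI {Γ : Ctx L} {π₁ π₂ : Pf L} {A B C : Fm L} :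
      ND E Γ π₁ A → ND E Γ π₂ B → E.fm C (.and A B) → ND E Γ (.pair π₁ π₂) C
  | andE₁ {Γ : Ctx L} {π : Pf L} {A B C : Fm L} :
      ND E Γ π C → E.fm C (.and A B) → ND E Γ (.fst π) A
  | andE₂ {Γ : Ctx L} {π : Pf L} {A B C : Fm L} :
      ND E Γ π C → E.fm C (.and A B) → ND E Γ (.snd π) B
  | orI₁ {Γ : Ctx L} {π : Pf L} {A B C : Fm L} :
      ND E Γ π A → E.fm C (.or A B) → ND E Γ (.inl π) C
  | orI₂ {Γ : Ctx L} {π : Pf L} {A B C : Fm L} :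
      ND E Γ π B → E.fm C (.or A B) → ND E Γ (.inr π) C
  | orE {Γ : Ctx L} {π₁ π₂ π₃ : Pf L} {α β : ℕ} {A B C D : Fm L} :
      ND E Γ π₁ D → E.fm D (.or A B) → ND E ((α, A) :: Γ) π₂ C →
      ND E ((β, B) :: Γ) π₃ C → ND E Γ (.case π₁ α π₂ β π₃) C
  | impI {Γ : Ctx L} {π : Pf L} {α : ℕ} {A B C : Fm L} :
      ND E ((α, A) :: Γ) π B → E.fm C (.imp A B) → ND E Γ (.lam α π) C
  | impE {Γ : Ctx L} {π₁ π₂ : Pf L} {A B C : Fm L} :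
      ND E Γ π₁ C → E.fm C (.imp A B) → ND E Γ π₂ A → ND E Γ (.app π₁ π₂) B
  | allI {Γ : Ctx L} {π : Pf L} {x : ℕ} {s : L.Srt} {A B : Fm L} :
      ND E Γ π A → E.fm B (.all x s A) → (s, x) ∉ ctxFv Γ → ND E Γ (.tlam x s π) B
  | allE {Γ : Ctx L} {π : Pf L} {x : ℕ} {s : L.Srt} {t : Tm L s} {A B C : Fm L} :
      ND E Γ π B → E.fm B (.all x s A) → E.fm C (A.subst x t) → ND E Γ (.tapp π s t) C
  | exI {Γ : Ctx L} {π : Pf L} {x : ℕ} {s : L.Srt} {t : Tm L s} {A B C : Fm L} :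
      ND E Γ π C → E.fm B (.ex x s A) → E.fm C (A.subst x t) → ND E Γ (.wit s t π) B
  | exE {Γ : Ctx L} {π₁ π₂ : Pf L} {x α : ℕ} {s : L.Srt} {A B C : Fm L} :
      ND E Γ π₁ C → E.fm C (.ex x s A) → ND E ((α, A) :: Γ) π₂ B →
      (s, x) ∉ ctxFv Γ ∪ B.fv → ND E Γ (.exElim π₁ x s α π₂) B

/-- A rewrite system rewriting terms to terms and atomic propositions to
propositions. -/
structure RW (L : Lang) where
  tmRules : Set ((s : L.Srt) × (Tm L s × Tm L s))
  fmRules : Set (Fm L × Fm L)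
  fm_atomic : ∀ p ∈ fmRules, ∃ P args, p.1 = Fm.atom P args

/-- One-step rewriting on terms (an instance of a rule, at any position). -/
inductive StepT (R : RW L) : {s : L.Srt} → Tm L s → Tm L s → Prop where
  | rule {s : L.Srt} {l r : Tm L s} (σ : Sub L) :
      (⟨s, (l, r)⟩ : (s : L.Srt) × (Tm L s × Tm L s)) ∈ R.tmRules →
      StepT R (l.ssub σ) (r.ssub σ)
  | app (f : L.Fn) (args : (i : Fin (L.arity f)) → Tm L (L.dom f i)) (i : Fin (L.arity f))
      {u : Tm L (L.dom f i)} :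
      StepT R (args i) u → StepT R (.app f args) (.app f (Function.update args i u))

/-- One-step rewriting on propositions (an instance of a rule, at any position). -/
inductive StepF (R : RW L) : Fm L → Fm L → Prop where
  | rule {l r : Fm L} (σ : Sub L) : (l, r) ∈ R.fmRules → StepF R (l.ssub σ) (r.ssub σ)
  | atom (P : L.Pr) (args : (i : Fin (L.parity P)) → Tm L (L.pdom P i)) (i : Fin (L.parity P))
      {u : Tm L (L.pdom P i)} :
      StepT R (args i) u → StepF R (.atom P args) (.atom P (Function.update args i u))
  | and₁ {A A' : Fm L} (B : Fm L) : StepF R A A' → StepF R (.and A B) (.and A' B)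
  | and₂ (A : Fm L) {B B' : Fm L} : StepF R B B' → StepF R (.and A B) (.and A B')
  | or₁ {A A' : Fm L} (B : Fm L) : StepF R A A' → StepF R (.or A B) (.or A' B)
  | or₂ (A : Fm L) {B B' : Fm L} : StepF R B B' → StepF R (.or A B) (.or A B')
  | imp₁ {A A' : Fm L} (B : Fm L) : StepF R A A' → StepF R (.imp A B) (.imp A' B)
  | imp₂ (A : Fm L) {B B' : Fm L} : StepF R B B' → StepF R (.imp A B) (.imp A B')
  | all (x : ℕ) (s : L.Srt) {A A' : Fm L} : StepF R A A' → StepF R (.all x s A) (.all x s A')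
  | ex (x : ℕ) (s : L.Srt) {A A' : Fm L} : StepF R A A' → StepF R (.ex x s A) (.ex x s A')

/-- Confluence of a relation. -/
def Confluent {α : Type*} (r : α → α → Prop) : Prop :=
  ∀ a b c : α, Relation.ReflTransGen r a b → Relation.ReflTransGen r a c →
    ∃ d, Relation.ReflTransGen r b d ∧ Relation.ReflTransGen r c d

/-- Atomic propositions. -/
def isAtomF : Fm L → Prop := fun A => ∃ P args, A = Fm.atom P args

/-- A relation on propositions is non-confusing. -/
def NonConfusing (Req : Fm L → Fm L → Prop) : Prop :=
  ∀ A B : Fm L, Req A B → ¬ isAtomF A → ¬ isAtomF B →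
    (A = .top ∧ B = .top) ∨
    (A = .bot ∧ B = .bot) ∨
    (∃ A₁ A₂ B₁ B₂, A = .and A₁ A₂ ∧ B = .and B₁ B₂ ∧ Req A₁ B₁ ∧ Req A₂ B₂) ∨
    (∃ A₁ A₂ B₁ B₂, A = .or A₁ A₂ ∧ B = .or B₁ B₂ ∧ Req A₁ B₁ ∧ Req A₂ B₂) ∨
    (∃ A₁ A₂ B₁ B₂, A = .imp A₁ A₂ ∧ B = .imp B₁ B₂ ∧ Req A₁ B₁ ∧ Req A₂ B₂) ∨
    (∃ x s A₁ B₁, A = .all x s A₁ ∧ B = .all x s B₁ ∧ Req A₁ B₁) ∨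
    (∃ x s A₁ B₁, A = .ex x s A₁ ∧ B = .ex x s B₁ ∧ Req A₁ B₁)


/-- Same head symbol with related components. -/
inductive SameHead (Q : Fm L → Fm L → Prop) : Fm L → Fm L → Prop where
  | top : SameHead Q .top .top
  | bot : SameHead Q .bot .bot
  | and {A A' B B' : Fm L} : Q A A' → Q B B' → SameHead Q (.and A B) (.and A' B')
  | or {A A' B B' : Fm L} : Q A A' → Q B B' → SameHead Q (.or A B) (.or A' B')
  | imp {A A' B B' : Fm L} : Q A A' → Q B B' → SameHead Q (.imp A B) (.imp A' B')
  | all (x : ℕ) (s : L.Srt) {A A' : Fm L} : Q A A' → SameHead Q (.all x s A) (.all x s A')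
  | ex (x : ℕ) (s : L.Srt) {A A' : Fm L} : Q A A' → SameHead Q (.ex x s A) (.ex x s A')

theorem sameHead_refl {r : Fm L → Fm L → Prop} {A : Fm L} (h : ¬ isAtomF A) :
    SameHead (Relation.EqvGen r) A A := by
  cases A with
  | atom P args => exact absurd ⟨P, args, rfl⟩ h
  | _ => constructor <;> exact .refl _

theorem sameHead_symm {r : Fm L → Fm L → Prop} {A B : Fm L}
    (h : SameHead (Relation.EqvGen r) A B) : SameHead (Relation.EqvGen r) B A := by
  cases h <;> constructor <;> apply Relation.EqvGen.symm <;> assumption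

theorem sameHead_trans {r : Fm L → Fm L → Prop} {A B C : Fm L}
    (h : SameHead (Relation.EqvGen r) A B) (h' : SameHead (Relation.EqvGen r) B C) :
    SameHead (Relation.EqvGen r) A C := by
  cases h <;> cases h' <;> constructor <;>
    exact Relation.EqvGen.trans _ _ _ (by assumption) (by assumption)

theorem sameHead_not_atom {Q : Fm L → Fm L → Prop} {A B : Fm L}
    (h : SameHead Q A B) : ¬ isAtomF B := by
  rintro ⟨P, args, rfl⟩
  cases h

theorem sameHead_step {R : RW L} {A B : Fm L} (h : StepF R A B) (hA : ¬ isAtomF A) :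
    SameHead (Relation.EqvGen (StepF R)) A B := by
  cases h with
  | rule σ hm =>
    obtain ⟨P, args, hp⟩ := R.fm_atomic _ hm
    simp only at hp
    subst hp
    exact absurd ⟨P, _, rfl⟩ hA
  | atom P args i _ => exact absurd ⟨P, _, rfl⟩ hA
  | _ => constructor <;> first | exact .refl _ | exact .rel _ _ (by assumption)

theorem sameHead_star {R : RW L} {A B : Fm L} (h : Relation.ReflTransGen (StepF R) A B)
    (hA : ¬ isAtomF A) : SameHead (Relation.EqvGen (StepF R)) A B := by
  induction h with
  | refl => exact sameHead_refl hA
  | tail _ hs ih => exact sameHead_trans ih (sameHead_step hs (sameHead_not_atom ih))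

theorem join_of_eqvGen {α : Type*} {r : α → α → Prop} (hc : Confluent r) {a b : α}
    (h : Relation.EqvGen r a b) :
    ∃ d, Relation.ReflTransGen r a d ∧ Relation.ReflTransGen r b d := by
  induction h with
  | rel x y h => exact ⟨y, .single h, .refl⟩
  | refl x => exact ⟨x, .refl, .refl⟩
  | symm x y _ ih => exact ih.imp fun _ h => h.symm
  | trans x y z _ _ ih₁ ih₂ =>
    obtain ⟨d, h₁, h₂⟩ := ih₁
    obtain ⟨e, h₃, h₄⟩ := ih₂
    obtain ⟨f, h₅, h₆⟩ := hc _ _ _ h₂ h₃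
    exact ⟨f, h₁.trans h₅, h₄.trans h₆⟩

/-- If a congruence is defined by a confluent rewrite system whose
rules rewrite terms to terms and atomic propositions to propositions, then it is
non-confusing. -/
theorem nonconfusing_of_confluent (L : Lang) (R : RW L)
    (hT : ∀ s : L.Srt, Confluent (fun t u : Tm L s => StepT R t u))
    (hF : Confluent (StepF R)) :
    NonConfusing (Relation.EqvGen (StepF R)) := by
  intro A B hAB hA hB
  obtain ⟨D, h₁, h₂⟩ := join_of_eqvGen hF hAB
  have h := sameHead_trans (sameHead_star h₁ hA) (sameHead_symm (sameHead_star h₂ hB))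
  cases h with
  | top => exact .inl ⟨rfl, rfl⟩
  | bot => exact .inr (.inl ⟨rfl, rfl⟩)
  | and a b => exact .inr (.inr (.inl ⟨_, _, _, _, rfl, rfl, a, b⟩))
  | or a b => exact .inr (.inr (.inr (.inl ⟨_, _, _, _, rfl, rfl, a, b⟩)))
  | imp a b => exact .inr (.inr (.inr (.inr (.inl ⟨_, _, _, _, rfl, rfl, a, b⟩))))
  | all x s a => exact .inr (.inr (.inr (.inr (.inr (.inl ⟨x, s, _, _, rfl, rfl, a⟩)))))
  | ex x s a => exact .inr (.inr (.inr (.inr (.inr (.inr ⟨x, s, _, _, rfl, rfl, a⟩)))))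

end DeductionModulo
end

section
/- If a congruence ≡ is non-confusing, then every normal closed proof in intuitionistic natural deduction modulo ≡ ends with an introduction rule. -/
set_option maxHeartbeats 1000000

attribute [local instance] Classical.propDecidable

namespace DeductionModulo

variable {L : Lang}

/-- If a congruence `≡` is non-confusing, then every normal closed
proof in natural deduction modulo `≡` ends with an introduction rule. -/
theorem normal_closed_proofs_end_with_intro (L : Lang) (E : Congr L)
    (h : NonConfusing E.fm) :
    ∀ (π : Pf L) (A : Fm L), ND E [] π A → Normal π → ClosedPf π → isIntro π := by
  intro π A hd hn hc
  clear hc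
  generalize hΓ : ([] : Ctx L) = Γ at hd
  induction hd with
  | ax hm _ => subst hΓ; simp at hm
  | topI _ => trivial
  | andI _ _ _ _ _ => trivial
  | orI₁ _ _ _ => trivial
  | orI₂ _ _ _ => trivial
  | impI _ _ _ => trivial
  | allI _ _ _ _ => trivial
  | exI _ _ _ _ => trivial
  | botE d e ih =>
    have hi := ih (fun _ r => hn _ (.botElimC r)) hΓ
    exfalso
    cases d <;> simp only [isIntro] at hi <;>
    · skip
      have := h _ _ (E.fm_trans (E.fm_symm e) (by assumption)) (by simp [isAtomF]) (by simp [isAtomF])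
      simp at this
  | andE₁ d e ih =>
    have hi := ih (fun _ r => hn _ (.fstC r)) hΓ
    exfalso
    cases d <;> simp only [isIntro] at hi
    case andI => exact hn _ (.fstPair _ _)
    all_goals
      have := h _ _ (E.fm_trans (E.fm_symm e) (by assumption)) (by simp [isAtomF]) (by simp [isAtomF])
      simp at this
  | andE₂ d e ih =>
    have hi := ih (fun _ r => hn _ (.sndC r)) hΓ
    exfalso
    cases d <;> simp only [isIntro] at hi
    case andI => exact hn _ (.sndPair _ _)
    all_goals
      have := h _ _ (E.fm_trans (E.fm_symm e) (by assumption)) (by simp [isAtomF]) (by simp [isAtomF])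
      simp at this
  | orE d e _ _ ih _ _ =>
    have hi := ih (fun _ r => hn _ (.caseC₁ _ _ _ _ r)) hΓ
    exfalso
    cases d <;> simp only [isIntro] at hi
    case orI₁ => exact hn _ (.caseInl _ _ _ _ _)
    case orI₂ => exact hn _ (.caseInr _ _ _ _ _)
    all_goals
      have := h _ _ (E.fm_trans (E.fm_symm e) (by assumption)) (by simp [isAtomF]) (by simp [isAtomF])
      simp at this
  | impE d e _ ih _ =>
    have hi := ih (fun _ r => hn _ (.appC₁ _ r)) hΓ
    exfalso
    cases d <;> simp only [isIntro] at hi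
    case impI => exact hn _ (.beta _ _ _)
    all_goals
      have := h _ _ (E.fm_trans (E.fm_symm e) (by assumption)) (by simp [isAtomF]) (by simp [isAtomF])
      simp at this
  | allE d e _ ih =>
    have hi := ih (fun _ r => hn _ (.tappC _ _ r)) hΓ
    exfalso
    cases d <;> simp only [isIntro] at hi
    case allI =>
      have := h _ _ (E.fm_trans (E.fm_symm e) (by assumption)) (by simp [isAtomF]) (by simp [isAtomF])
      simp at this
      obtain ⟨⟨rfl, rfl⟩, _⟩ := this
      exact hn _ (.tbeta _ _ _ _)
    all_goals
      have := h _ _ (E.fm_trans (E.fm_symm e) (by assumption)) (by simp [isAtomF]) (by simp [isAtomF])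
      simp at this
  | exE d e _ _ ih _ =>
    have hi := ih (fun _ r => hn _ (.exElimC₁ _ _ _ _ r)) hΓ
    exfalso
    cases d <;> simp only [isIntro] at hi
    case exI =>
      have := h _ _ (E.fm_trans (E.fm_symm e) (by assumption)) (by simp [isAtomF]) (by simp [isAtomF])
      simp at this
      obtain ⟨⟨rfl, rfl⟩, _⟩ := this
      exact hn _ (.exBeta _ _ _ _ _ _)
    all_goals
      have := h _ _ (E.fm_trans (E.fm_symm e) (by assumption)) (by simp [isAtomF]) (by simp [isAtomF])
      simp at this

end DeductionModulo
end
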